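/- arXiv:1810.07432 — 2 statements merged into one kernel-verified Lean document; each statement's English description precedes it below -/
import Mathlib

section
/- Let A ⊂ ℝ^4 be a 3-dimensional linear subspace spanned by three vectors with rational coordinates. Then there exists κ > 0 such that every 2-dimensional linear subspace C ⊂ A satisfies ψ_C(T) ≤ κ·T^{−2} for all T ≥ 2. Consequently ω(C) ≥ 2, and C is not ρT^{−β}-badly approximable for any β < 2 and ρ > 0. -/
open MeasureTheory Filter

noncomputable section

/-- The sup-norm of a vector in Euclidean space. -/
def supNorm {d : ℕ} (w : EuclideanSpace ℝ (Fin d)) : ℝ := ⨆ i, |w i|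

/-- The point of `ℝ^d` (with Euclidean metric) corresponding to an integer vector. -/
def intVec {d : ℕ} (z : Fin d → ℤ) : EuclideanSpace ℝ (Fin d) :=
  (WithLp.equiv 2 (Fin d → ℝ)).symm (fun i => (z i : ℝ))

/-- The irrationality measure function `ψ_B` of a linear subspace of `ℝ^d`:
`ψ_B(t) = inf { dist(z, B) : z ∈ ℤ^d, 1 ≤ |z| < t }`. -/
def psiSub {d : ℕ} (B : Submodule ℝ (EuclideanSpace ℝ (Fin d))) (t : ℝ) : ℝ :=
  sInf ((fun z : Fin d → ℤ =>
      Metric.infDist (intVec z) (B : Set (EuclideanSpace ℝ (Fin d)))) ''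
    {z | 1 ≤ supNorm (intVec z) ∧ supNorm (intVec z) < t})

/-- The Diophantine exponent of a linear subspace of `ℝ^d`:
`ω(B) = sup { γ : liminf_{t→∞} t^γ ψ_B(t) < ∞ }`, as an extended real number. -/
def diophExp {d : ℕ} (B : Submodule ℝ (EuclideanSpace ℝ (Fin d))) : EReal :=
  sSup {x : EReal | ∃ γ : ℝ, x = (γ : EReal) ∧
    Filter.liminf (fun t : ℝ => ENNReal.ofReal (t ^ γ * psiSub B t)) Filter.atTop < ⊤}

/-- The graph subspace `C(Θ)` of an `(a-c)×c` matrix `Θ`, relative to an orthonormal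
basis `e` of an `a`-dimensional subspace of `ℝ^d`:
`C(Θ) = { ∑ x_j e_j + ∑_i (∑_j θ_{ij} x_j) e_{c+i} : x ∈ ℝ^c }`. -/
def graphSub (d a c : ℕ) (hca : c ≤ a) (e : Fin a → EuclideanSpace ℝ (Fin d))
    (Θ : Fin (a - c) → Fin c → ℝ) : Submodule ℝ (EuclideanSpace ℝ (Fin d)) :=
  Submodule.span ℝ {v | ∃ x : Fin c → ℝ,
    v = (∑ j : Fin c, x j • e (Fin.castLE hca j)) +
        ∑ i : Fin (a - c), (∑ j : Fin c, Θ i j * x j) • e ⟨c + i.1, by have := i.2; omega⟩}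

/-- A quantitative Dirichlet lemma: a linear form in three variables with coefficients bounded by
`M` takes a small value at a nonzero integer point of the box of size `N`. -/
lemma exists_int_linearForm_small {M : ℝ} (hM : 0 < M) (l : Fin 3 → ℝ) (hl : ∀ k, |l k| ≤ M)
    {N : ℕ} (hN : 1 ≤ N) :
    ∃ x : Fin 3 → ℤ, x ≠ 0 ∧ (∀ k, |(x k : ℝ)| ≤ N) ∧
      |∑ k, (x k : ℝ) * l k| ≤ 6 * M / (N : ℝ) ^ 2 := by
  have hN0 : (0 : ℝ) < N := by exact_mod_cast hN
  set s : (Fin 3 → Fin (N + 1)) → ℝ := fun a => ∑ k, ((a k : ℕ) : ℝ) * l k with hs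
  have hsb : ∀ a, |s a| ≤ 3 * M * N := by
    intro a
    calc |s a| ≤ ∑ k, |((a k : ℕ) : ℝ) * l k| := Finset.abs_sum_le_sum_abs _ _
      _ ≤ ∑ _k : Fin 3, (N : ℝ) * M := by
          refine Finset.sum_le_sum fun k _ => ?_
          rw [abs_mul, Nat.abs_cast]
          have h : ((a k : ℕ) : ℝ) ≤ N := by exact_mod_cast Nat.lt_succ_iff.mp (a k).2
          exact mul_le_mul h (hl k) (abs_nonneg _) hN0.le
      _ = 3 * M * N := by simp; ring
  set c : ℝ := (N : ℝ) ^ 2 / (6 * M) with hc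
  have hc0 : 0 < c := by positivity
  set f : (Fin 3 → Fin (N + 1)) → ℕ := fun a => ⌊(s a + 3 * M * N) * c⌋₊ with hf
  have hnn : ∀ a, 0 ≤ (s a + 3 * M * N) * c := fun a =>
    mul_nonneg (by linarith [(abs_le.mp (hsb a)).1]) hc0.le
  have hmaps : ∀ a ∈ (Finset.univ : Finset (Fin 3 → Fin (N + 1))),
      f a ∈ Finset.range (N ^ 3 + 1) := by
    intro a _
    rw [Finset.mem_range, Nat.lt_succ_iff]
    refine Nat.floor_le_of_le ?_
    calc (s a + 3 * M * N) * c ≤ (6 * M * N) * c :=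
          mul_le_mul_of_nonneg_right (by linarith [(abs_le.mp (hsb a)).2]) hc0.le
      _ = ((N ^ 3 : ℕ) : ℝ) := by
          rw [hc]; push_cast; field_simp
  have hcard : (Finset.range (N ^ 3 + 1)).card
      < (Finset.univ : Finset (Fin 3 → Fin (N + 1))).card := by
    simp only [Finset.card_range, Finset.card_univ, Fintype.card_fun, Fintype.card_fin]
    ring_nf
    nlinarith
  obtain ⟨a, -, b, -, hab, hfab⟩ := Finset.exists_ne_map_eq_of_card_lt_of_maps_to hcard hmaps
  refine ⟨fun k => ((a k : ℕ) : ℤ) - ((b k : ℕ) : ℤ), ?_, ?_, ?_⟩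
  · intro h
    refine hab (funext fun k => Fin.ext ?_)
    have := congrFun h k
    simp only [Pi.zero_apply] at this
    omega
  · intro k
    have ha : ((a k : ℕ) : ℝ) ≤ N := by exact_mod_cast Nat.lt_succ_iff.mp (a k).2
    have hb : ((b k : ℕ) : ℝ) ≤ N := by exact_mod_cast Nat.lt_succ_iff.mp (b k).2
    have ha' : (0 : ℝ) ≤ ((a k : ℕ) : ℝ) := Nat.cast_nonneg _
    have hb' : (0 : ℝ) ≤ ((b k : ℕ) : ℝ) := Nat.cast_nonneg _
    push_cast
    rw [abs_le]
    constructor <;> linarith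
  · have hsum : ∑ k, (((((a k : ℕ) : ℤ) - ((b k : ℕ) : ℤ) : ℤ)) : ℝ) * l k = s a - s b := by
      simp only [hs, ← Finset.sum_sub_distrib]
      refine Finset.sum_congr rfl fun k _ => ?_
      push_cast
      ring
    rw [hsum]
    have h1 := Nat.floor_le (hnn a)
    have h2 := Nat.lt_floor_add_one ((s a + 3 * M * N) * c)
    have h3 := Nat.floor_le (hnn b)
    have h4 := Nat.lt_floor_add_one ((s b + 3 * M * N) * c)
    have hfl : (⌊(s a + 3 * M * N) * c⌋₊ : ℝ) = ⌊(s b + 3 * M * N) * c⌋₊ := by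
      exact_mod_cast hfab
    have h5 : |s a - s b| * c ≤ 1 := by
      rw [← abs_of_pos hc0, ← abs_mul, abs_le]
      constructor <;> nlinarith
    have h6 : 6 * M / (N : ℝ) ^ 2 = 1 / c := by rw [hc, one_div_div]
    rwa [h6, le_div_iff₀ hc0]

/-- The distance to a hyperplane `C` of `A` is controlled on `A` by a linear form of norm at most
one. -/
lemma exists_linearForm_infDist_le {E : Type*} [NormedAddCommGroup E] [InnerProductSpace ℝ E]
    [FiniteDimensional ℝ E] {A C : Submodule ℝ E} (hCA : C ≤ A)
    (hfin : Module.finrank ℝ A = Module.finrank ℝ C + 1)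
    {ι : Type*} [Fintype ι] (u : ι → E) (hu : ∀ k, u k ∈ A) :
    ∃ l : ι → ℝ, (∀ k, |l k| ≤ ‖u k‖) ∧
      ∀ x : ι → ℝ, Metric.infDist (∑ k, x k • u k) (C : Set E) ≤ |∑ k, x k * l k| := by
  have h1 : Module.finrank ℝ (Cᗮ ⊓ A : Submodule ℝ E) = 1 := by
    have := Submodule.finrank_add_inf_finrank_orthogonal hCA
    omega
  obtain ⟨w, hw0, hw⟩ := finrank_eq_one_iff'.mp h1
  have hwn : ‖(w : E)‖ ≠ 0 := by simpa using hw0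
  have hmem : ∀ k, u k - C.starProjection (u k) ∈ (Cᗮ ⊓ A : Submodule ℝ E) := fun k =>
    ⟨C.sub_starProjection_mem_orthogonal (u k),
      A.sub_mem (hu k) (hCA (C.starProjection_apply_mem (u k)))⟩
  choose c hc using fun k => hw ⟨_, hmem k⟩
  have hc' : ∀ k, c k • (w : E) = u k - C.starProjection (u k) := fun k =>
    congrArg Subtype.val (hc k)
  refine ⟨fun k => c k * ‖(w : E)‖, fun k => ?_, fun x => ?_⟩
  · rw [abs_mul, abs_norm, ← Real.norm_eq_abs, ← norm_smul, hc' k]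
    rw [← Submodule.starProjection_orthogonal_val]
    exact Submodule.norm_starProjection_apply_le _ _
  · have hp : ∑ k, x k • C.starProjection (u k) ∈ C :=
      C.sum_mem fun k _ => C.smul_mem _ (C.starProjection_apply_mem (u k))
    refine (Metric.infDist_le_dist_of_mem hp).trans (le_of_eq ?_)
    rw [dist_eq_norm, ← Finset.sum_sub_distrib]
    have : ∑ k, (x k • u k - x k • C.starProjection (u k)) = (∑ k, x k * c k) • (w : E) := by
      rw [Finset.sum_smul]
      refine Finset.sum_congr rfl fun k _ => ?_
      rw [← smul_sub, ← hc' k, smul_smul]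
    rw [this, norm_smul, Real.norm_eq_abs, ← abs_norm (w : E), ← abs_mul, Finset.sum_mul,
      abs_norm]
    simp only [mul_assoc]

lemma intVec_apply {d : ℕ} (z : Fin d → ℤ) (i : Fin d) : intVec z i = (z i : ℝ) := rfl

lemma abs_le_supNorm {d : ℕ} (w : EuclideanSpace ℝ (Fin d)) (i : Fin d) : |w i| ≤ supNorm w :=
  le_ciSup (f := fun i => |w i|) (Set.finite_range _).bddAbove i

lemma supNorm_le_norm {d : ℕ} [NeZero d] (w : EuclideanSpace ℝ (Fin d)) : supNorm w ≤ ‖w‖ :=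
  ciSup_le fun i => by simpa using PiLp.norm_apply_le w i

lemma one_le_supNorm_intVec {d : ℕ} {z : Fin d → ℤ} (hz : z ≠ 0) : 1 ≤ supNorm (intVec z) := by
  obtain ⟨i, hi⟩ := Function.ne_iff.mp hz
  refine le_trans ?_ (abs_le_supNorm (intVec z) i)
  rw [intVec_apply]
  rw [← Int.cast_abs]
  exact_mod_cast Int.one_le_abs hi

lemma psiSub_le {d : ℕ} (B : Submodule ℝ (EuclideanSpace ℝ (Fin d))) {t : ℝ} {z : Fin d → ℤ}
    (hz : z ≠ 0) (hzt : supNorm (intVec z) < t) :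
    psiSub B t ≤ Metric.infDist (intVec z) (B : Set (EuclideanSpace ℝ (Fin d))) := by
  refine csInf_le ⟨0, ?_⟩ ⟨z, ⟨one_le_supNorm_intVec hz, hzt⟩, rfl⟩
  rintro _ ⟨y, -, rfl⟩
  exact Metric.infDist_nonneg

lemma intVec_single {d : ℕ} (i : Fin d) :
    intVec (Pi.single i 1) = EuclideanSpace.single i (1 : ℝ) := by
  ext j
  rw [intVec_apply]
  by_cases h : j = i
  · subst h; simp
  · simp [h]

lemma supNorm_intVec_single_le {d : ℕ} [NeZero d] (i : Fin d) :
    supNorm (intVec (Pi.single i 1)) ≤ 1 := by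
  refine (supNorm_le_norm _).trans ?_
  rw [intVec_single]
  simp

lemma psiSub_le_one {d : ℕ} [NeZero d] (B : Submodule ℝ (EuclideanSpace ℝ (Fin d))) {t : ℝ}
    (ht : 1 < t) : psiSub B t ≤ 1 := by
  refine (psiSub_le B (z := Pi.single 0 1) (by simp)
    ((supNorm_intVec_single_le 0).trans_lt ht)).trans ?_
  refine (Metric.infDist_le_dist_of_mem B.zero_mem).trans ?_
  rw [intVec_single]
  simp

lemma exists_int_smul_eq {ι κ : Type*} [Fintype ι] [Fintype κ] (q : ι → κ → ℚ) :
    ∃ D : ℤ, D ≠ 0 ∧ ∃ p : ι → κ → ℤ, ∀ k i, (p k i : ℝ) = D * (q k i : ℝ) := by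
  obtain ⟨D, hD⟩ := IsLocalization.exist_integer_multiples_of_finite (nonZeroDivisors ℤ)
    (fun a : ι × κ => q a.1 a.2)
  choose p hp using hD
  refine ⟨D, nonZeroDivisors.coe_ne_zero D, fun k i => p (k, i), fun k i => ?_⟩
  have := hp (k, i)
  simp only [algebraMap_int_eq, eq_intCast, zsmul_eq_mul] at this
  exact_mod_cast congrArg (fun r : ℚ => (r : ℝ)) this

/-- The uniform bound `ψ_C(T) ≤ κ T⁻²` for planes in a space with an integral basis. -/
lemma exists_psiSub_le {d : ℕ} [NeZero d] (A : Submodule ℝ (EuclideanSpace ℝ (Fin d)))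
    (p : Fin 3 → Fin d → ℤ) (hp : LinearIndependent ℝ fun k => intVec (p k))
    (hpA : ∀ k, intVec (p k) ∈ A) (hA : Module.finrank ℝ A = 3) :
    ∃ κ : ℝ, 0 < κ ∧ ∀ C : Submodule ℝ (EuclideanSpace ℝ (Fin d)), C ≤ A →
      Module.finrank ℝ C = 2 → ∀ T : ℝ, 2 ≤ T → psiSub C T ≤ κ * T ^ (-2 : ℝ) := by
  set M : ℝ := 1 + ∑ k, ‖intVec (p k)‖ with hMdef
  have hM1 : 1 ≤ M := by
    have : 0 ≤ ∑ k, ‖intVec (p k)‖ := Finset.sum_nonneg fun _ _ => norm_nonneg _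
    linarith
  have hM : ∀ k, ‖intVec (p k)‖ ≤ M := fun k => by
    have := Finset.single_le_sum (f := fun k => ‖intVec (p k)‖) (fun _ _ => norm_nonneg _)
      (Finset.mem_univ k)
    linarith
  have hM0 : 0 < M := by linarith
  refine ⟨864 * M ^ 3, by positivity, fun C hCA hC T hT => ?_⟩
  have hT0 : 0 < T := by linarith
  have hTpow : T ^ (-2 : ℝ) = 1 / T ^ 2 := by
    rw [Real.rpow_neg hT0.le, one_div]
    norm_cast
  rw [hTpow, mul_one_div]
  rcases le_total T (6 * M) with hTM | hTM
  · refine (psiSub_le_one C (by linarith)).trans ?_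
    rw [le_div_iff₀ (by positivity), one_mul]
    have h1 : T ^ 2 ≤ (6 * M) ^ 2 := pow_le_pow_left₀ hT0.le hTM 2
    have h2 : M ^ 2 ≤ M ^ 3 := pow_le_pow_right₀ hM1 (by norm_num)
    nlinarith [sq_nonneg M]
  set N : ℕ := ⌊T / (6 * M)⌋₊ with hNdef
  have hquot : 1 ≤ T / (6 * M) := by rwa [le_div_iff₀ (by positivity), one_mul]
  have hN1 : 1 ≤ N := Nat.le_floor (by exact_mod_cast hquot)
  have hN1' : (1 : ℝ) ≤ N := by exact_mod_cast hN1
  have hNle : (N : ℝ) * (6 * M) ≤ T := by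
    rw [← le_div_iff₀ (by positivity)]
    exact Nat.floor_le (by linarith)
  have hNge : T ≤ (12 * M) * N := by
    have h := Nat.lt_floor_add_one (T / (6 * M))
    rw [div_lt_iff₀ (by positivity)] at h
    nlinarith
  obtain ⟨l, hl, hdist⟩ := exists_linearForm_infDist_le hCA (by omega) _ hpA
  obtain ⟨x, hx0, hxN, hx⟩ :=
    exists_int_linearForm_small hM0 l (fun k => (hl k).trans (hM k)) hN1
  set z : Fin d → ℤ := ∑ k, x k • p k with hz
  have hzsum : intVec z = ∑ k, (x k : ℝ) • intVec (p k) := by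
    ext i
    simp [intVec_apply, hz]
  have hz0 : z ≠ 0 := by
    intro h
    refine hx0 (funext fun k => ?_)
    have h0 : ∑ k, (x k : ℝ) • intVec (p k) = 0 := by
      rw [← hzsum, h]
      ext i
      simp [intVec_apply]
    exact_mod_cast Fintype.linearIndependent_iff.mp hp _ h0 k
  have hzT : supNorm (intVec z) < T := by
    refine (supNorm_le_norm _).trans_lt ?_
    calc ‖intVec z‖ ≤ ∑ k, ‖(x k : ℝ) • intVec (p k)‖ := by
          rw [hzsum]; exact norm_sum_le _ _
      _ ≤ ∑ _k : Fin 3, (N : ℝ) * M := by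
          refine Finset.sum_le_sum fun k _ => ?_
          rw [norm_smul, Real.norm_eq_abs]
          exact mul_le_mul (hxN k) (hM k) (norm_nonneg _) (by positivity)
      _ = 3 * (N * M) := by simp
      _ < T := by nlinarith [mul_pos (zero_lt_one.trans_le hN1') hM0]
  refine (psiSub_le C hz0 hzT).trans ?_
  rw [hzsum]
  refine ((hdist _).trans hx).trans ?_
  rw [div_le_div_iff₀ (by positivity) (by positivity)]
  have : T ^ 2 ≤ (12 * M * N) ^ 2 := pow_le_pow_left₀ hT0.le hNge 2
  calc 6 * M * T ^ 2 ≤ 6 * M * (12 * M * N) ^ 2 := by gcongr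
    _ = 864 * M ^ 3 * N ^ 2 := by ring

lemma le_diophExp_of_psiSub_le {d : ℕ} {B : Submodule ℝ (EuclideanSpace ℝ (Fin d))} {γ κ : ℝ}
    (h : ∀ T : ℝ, 2 ≤ T → psiSub B T ≤ κ * T ^ (-γ)) : (γ : EReal) ≤ diophExp B := by
  refine le_sSup ⟨γ, rfl, lt_of_le_of_lt ?_ (ENNReal.ofReal_lt_top (r := κ))⟩
  refine Filter.liminf_le_of_frequently_le' (Filter.Eventually.frequently ?_)
  filter_upwards [Filter.eventually_ge_atTop 2] with T hT
  have hT0 : 0 < T := by linarith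
  refine ENNReal.ofReal_le_ofReal ?_
  calc T ^ γ * psiSub B T ≤ T ^ γ * (κ * T ^ (-γ)) :=
        mul_le_mul_of_nonneg_left (h T hT) (by positivity)
    _ = κ * (T ^ γ * T ^ (-γ)) := by ring
    _ = κ := by rw [← Real.rpow_add hT0]; simp

lemma not_badlyApproximable_of_psiSub_le {d : ℕ} [NeZero d]
    {B : Submodule ℝ (EuclideanSpace ℝ (Fin d))} {γ κ β ρ : ℝ}
    (h : ∀ T : ℝ, 2 ≤ T → psiSub B T ≤ κ * T ^ (-γ)) (hγ : 0 < γ) (hβ : β < γ) (hρ : 0 < ρ) :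
    ¬ ∀ z : Fin d → ℤ, z ≠ 0 → ρ * supNorm (intVec z) ^ (-β) ≤
      Metric.infDist (intVec z) (B : Set (EuclideanSpace ℝ (Fin d))) := by
  intro hbad
  set b := max β 0 with hb
  have hbγ : 0 < γ - b := sub_pos.mpr (max_lt hβ hγ)
  have hlow : ∀ T : ℝ, 2 ≤ T → ρ * T ^ (-b) ≤ psiSub B T := by
    intro T hT
    refine le_csInf (Set.Nonempty.image _ ⟨Pi.single 0 1, ?_, ?_⟩) ?_
    · exact one_le_supNorm_intVec (by simp)
    · exact (supNorm_intVec_single_le 0).trans_lt (by linarith)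
    · rintro _ ⟨z, ⟨hz1, hzT⟩, rfl⟩
      have hz0 : z ≠ 0 := by
        rintro rfl
        have : supNorm (intVec (0 : Fin d → ℤ)) = 0 := by simp [supNorm, intVec_apply]
        linarith
      refine le_trans (mul_le_mul_of_nonneg_left ?_ hρ.le) (hbad z hz0)
      calc T ^ (-b) ≤ supNorm (intVec z) ^ (-b) :=
            Real.rpow_le_rpow_of_nonpos (by linarith) hzT.le (by simp [hb])
        _ ≤ supNorm (intVec z) ^ (-β) :=
            Real.rpow_le_rpow_of_exponent_le hz1 (neg_le_neg (le_max_left _ _))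
  obtain ⟨T, hT, hTbig⟩ := ((eventually_ge_atTop (2 : ℝ)).and
    ((tendsto_rpow_atTop hbγ).eventually_gt_atTop (κ / ρ))).exists
  have hT0 : 0 < T := by linarith
  have h1 := (hlow T hT).trans (h T hT)
  have h2 : T ^ (-b) = T ^ (γ - b) * T ^ (-γ) := by
    rw [← Real.rpow_add hT0]; congr 1; ring
  rw [h2, ← mul_assoc] at h1
  have h3 := le_of_mul_le_mul_right h1 (Real.rpow_pos_of_pos hT0 _)
  rw [div_lt_iff₀ hρ] at hTbig
  linarith

/-- if `A ⊆ ℝ^4` is a `3`-dimensional subspace spanned by three vectors with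
rational coordinates, then there is `κ > 0` such that every `2`-dimensional subspace `C ⊆ A`
satisfies `ψ_C(T) ≤ κ T^{−2}` for all `T ≥ 2`; consequently `ω(C) ≥ 2` and `C` is not
`ρT^{−β}`-badly approximable for any `β < 2` and `ρ > 0`. -/
theorem stmt_14 (A : Submodule ℝ (EuclideanSpace ℝ (Fin 4)))
    (v : Fin 3 → EuclideanSpace ℝ (Fin 4)) (q : Fin 3 → Fin 4 → ℚ)
    (hv : ∀ k, v k = (WithLp.equiv 2 (Fin 4 → ℝ)).symm (fun i => (q k i : ℝ)))
    (hA : A = Submodule.span ℝ (Set.range v)) (hdimA : Module.finrank ℝ A = 3) :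
    ∃ κ : ℝ, 0 < κ ∧
      ∀ C : Submodule ℝ (EuclideanSpace ℝ (Fin 4)), C ≤ A → Module.finrank ℝ C = 2 →
        (∀ T : ℝ, 2 ≤ T → psiSub C T ≤ κ * T ^ (-2 : ℝ)) ∧
        ((2 : ℝ) : EReal) ≤ diophExp C ∧
        ∀ β ρ : ℝ, β < 2 → 0 < ρ →
          ¬ (∀ z : Fin 4 → ℤ, z ≠ 0 →
            ρ * supNorm (intVec z) ^ (-β) ≤
              Metric.infDist (intVec z) (C : Set (EuclideanSpace ℝ (Fin 4)))) := by
  obtain ⟨D, hD0, p, hp⟩ := exists_int_smul_eq q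
  have hDR : (D : ℝ) ≠ 0 := by exact_mod_cast hD0
  have hpv : (fun k => intVec (p k)) = fun k => (D : ℝ) • v k := by
    funext k
    ext i
    rw [intVec_apply, hp, hv]
    simp
  have hvli : LinearIndependent ℝ v := by
    rw [linearIndependent_iff_card_eq_finrank_span, Set.finrank, ← hA, hdimA]
    simp
  have hpli : LinearIndependent ℝ fun k => intVec (p k) := by
    rw [hpv]
    exact hvli.units_smul fun _ => Units.mk0 (D : ℝ) hDR
  have hpA : ∀ k, intVec (p k) ∈ A := fun k => by
    rw [congrFun hpv k, hA]
    exact Submodule.smul_mem _ _ (Submodule.subset_span ⟨k, rfl⟩)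
  obtain ⟨κ, hκ, h⟩ := exists_psiSub_le A p hpli hpA hdimA
  refine ⟨κ, hκ, fun C hCA hC => ⟨h C hCA hC, le_diophExp_of_psiSub_le (h C hCA hC), ?_⟩⟩
  intro β ρ hβ hρ
  exact not_badlyApproximable_of_psiSub_le (h C hCA hC) two_pos hβ hρ

end
end

section
/- There exist a 2-dimensional linear subspace B ⊂ ℝ^4 and a constant ρ > 0 such that dist(z, B) ≥ ρ·|z|^{−1} for every nonzero z ∈ ℤ^4, i.e. B is ρT^{−1}-badly approximable. -/
open MeasureTheory Filter

noncomputable section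

/-- `√2` is badly approximable: `|p - √2 q| ≥ 1 / (3 max(|p|, |q|))`. -/
lemma one_le_three_mul_abs_sub_sqrt_two_mul (p q : ℤ) (h : p ≠ 0 ∨ q ≠ 0) {N : ℝ}
    (hp : |(p : ℝ)| ≤ N) (hq : |(q : ℝ)| ≤ N) : 1 ≤ 3 * N * |(p : ℝ) - √2 * q| := by
  have hsq : √2 * √2 = 2 := Real.mul_self_sqrt (by norm_num)
  have hs0 : 0 ≤ √2 := Real.sqrt_nonneg 2
  have hs2 : √2 ≤ 2 := by nlinarith
  have hirr : p ^ 2 - 2 * q ^ 2 ≠ 0 := by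
    intro h0
    have hq0 : q ≠ 0 := by
      rintro rfl
      simp_all
    refine irrational_sqrt_two.ne_rat |(p : ℚ) / q| ?_
    have hqR : (q : ℝ) ≠ 0 := by exact_mod_cast hq0
    have hpq : (p : ℝ) ^ 2 = 2 * (q : ℝ) ^ 2 := by
      have : p ^ 2 = 2 * q ^ 2 := by linarith
      exact_mod_cast this
    push_cast
    rw [← Real.sqrt_sq_eq_abs, div_pow, hpq, mul_div_assoc, div_self (pow_ne_zero 2 hqR), mul_one]
  have hone : (1 : ℝ) ≤ |(p : ℝ) + √2 * q| * |(p : ℝ) - √2 * q| := by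
    rw [← abs_mul]
    have : ((p : ℝ) + √2 * q) * (p - √2 * q) = ((p ^ 2 - 2 * q ^ 2 : ℤ) : ℝ) := by
      push_cast
      linear_combination (-(q : ℝ) ^ 2) * hsq
    rw [this]
    exact_mod_cast Int.one_le_abs hirr
  refine hone.trans (mul_le_mul_of_nonneg_right ?_ (abs_nonneg _))
  calc |(p : ℝ) + √2 * q| ≤ |(p : ℝ)| + |√2 * q| := abs_add_le _ _
    _ = |(p : ℝ)| + √2 * |(q : ℝ)| := by rw [abs_mul, abs_of_nonneg hs0]
    _ ≤ 3 * N := by nlinarith [abs_nonneg (q : ℝ)]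

/-- If two coordinates of `y` satisfy `y i = √2 * y j`, then an integer vector `z` with
`(z i, z j) ≠ 0` has distance at least `1 / (9 |z|)` from `y`. -/
lemma inv_supNorm_le_dist {d : ℕ} (z : Fin d → ℤ) (i j : Fin d) (h : z i ≠ 0 ∨ z j ≠ 0)
    (y : EuclideanSpace ℝ (Fin d)) (hy : y i = √2 * y j) :
    1 / 9 * (supNorm (intVec z))⁻¹ ≤ dist (intVec z) y := by
  have hi : |(z i : ℝ)| ≤ supNorm (intVec z) := abs_le_supNorm (intVec z) i
  have hj : |(z j : ℝ)| ≤ supNorm (intVec z) := abs_le_supNorm (intVec z) j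
  have hdi : |(z i : ℝ) - y i| ≤ dist (intVec z) y := by
    rw [dist_eq_norm]
    exact PiLp.norm_apply_le (intVec z - y) i
  have hdj : |(z j : ℝ) - y j| ≤ dist (intVec z) y := by
    rw [dist_eq_norm]
    exact PiLp.norm_apply_le (intVec z - y) j
  have key := one_le_three_mul_abs_sub_sqrt_two_mul (z i) (z j) h hi hj
  have hs0 : 0 ≤ √2 := Real.sqrt_nonneg 2
  have hs2 : √2 ≤ 2 := by nlinarith [Real.mul_self_sqrt (show (0 : ℝ) ≤ 2 by norm_num)]
  have hform : |(z i : ℝ) - √2 * z j| ≤ 3 * dist (intVec z) y := by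
    calc |(z i : ℝ) - √2 * z j| = |((z i : ℝ) - y i) - √2 * (z j - y j)| := by
          rw [hy]
          ring_nf
      _ ≤ |(z i : ℝ) - y i| + |√2 * (z j - y j)| := abs_sub _ _
      _ = |(z i : ℝ) - y i| + √2 * |(z j : ℝ) - y j| := by rw [abs_mul, abs_of_nonneg hs0]
      _ ≤ 3 * dist (intVec z) y := by nlinarith [abs_nonneg ((z j : ℝ) - y j)]
  have hN0 : 0 ≤ supNorm (intVec z) := (abs_nonneg _).trans hi
  have hN : 0 < supNorm (intVec z) := by
    refine hN0.lt_of_ne fun h0 => ?_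
    rw [← h0] at key
    norm_num at key
  rw [← div_eq_mul_inv, div_le_iff₀ hN]
  nlinarith [mul_le_mul_of_nonneg_left hform hN0]

/-- The parametrization `(a, b) ↦ (√2 a, a, √2 b, b)` of a plane in `ℝ^4`. -/
def sqrtTwoPlane : (Fin 2 → ℝ) →ₗ[ℝ] EuclideanSpace ℝ (Fin 4) where
  toFun v := !₂[√2 * v 0, v 0, √2 * v 1, v 1]
  map_add' v w := by
    ext i
    fin_cases i <;> simp [mul_add]
  map_smul' c v := by
    ext i
    fin_cases i <;> simp [mul_left_comm]

lemma sqrtTwoPlane_injective : Function.Injective sqrtTwoPlane := by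
  intro v w h
  ext i
  fin_cases i
  · exact congrArg (fun u : EuclideanSpace ℝ (Fin 4) => u 1) h
  · exact congrArg (fun u : EuclideanSpace ℝ (Fin 4) => u 3) h

/-- there exist a `2`-dimensional linear subspace `B ⊆ ℝ^4` and `ρ > 0` with
`dist(z, B) ≥ ρ |z|⁻¹` for every nonzero `z ∈ ℤ^4`, i.e. `B` is `ρT^{−1}`-badly approximable. -/
theorem stmt_15 :
    ∃ B : Submodule ℝ (EuclideanSpace ℝ (Fin 4)), Module.finrank ℝ B = 2 ∧
      ∃ ρ : ℝ, 0 < ρ ∧ ∀ z : Fin 4 → ℤ, z ≠ 0 →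
        ρ * (supNorm (intVec z))⁻¹ ≤
          Metric.infDist (intVec z) (B : Set (EuclideanSpace ℝ (Fin 4))) := by
  refine ⟨LinearMap.range sqrtTwoPlane, ?_, 1 / 9, by norm_num, fun z hz => ?_⟩
  · rw [LinearMap.finrank_range_of_inj sqrtTwoPlane_injective, Module.finrank_fin_fun]
  · rw [Metric.le_infDist ⟨0, Submodule.zero_mem _⟩]
    rintro _ ⟨v, rfl⟩
    by_cases h : z 0 ≠ 0 ∨ z 1 ≠ 0
    · exact inv_supNorm_le_dist z 0 1 h _ rfl
    · refine inv_supNorm_le_dist z 2 3 ?_ _ rfl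
      by_contra h'
      push Not at h h'
      refine hz (funext fun i => ?_)
      fin_cases i
      exacts [h.1, h.2, h'.1, h'.2]

end
end
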